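/- In the category of curved Lie algebras, the binary coproduct of $(\mathfrak g, d_{\mathfrak g}, \omega_{\mathfrak g})$ and $(\mathfrak h, d_{\mathfrak h}, \omega_{\mathfrak h})$ exists and is given by the free product Lie algebra $\mathfrak g * \mathfrak h * L\langle x\rangle$ on a formal degree-$1$ generator $x$, with differential $\tilde d$ determined by $\tilde d|_{\mathfrak g} = d_{\mathfrak g}$, $\tilde d|_{\mathfrak h} = d_{\mathfrak h} - [x,-]$, $\tilde d(x) = \omega_{\mathfrak h} - \omega_{\mathfrak g} - \frac12[x,x]$, and curvature $\omega_{\mathfrak g}$; the structure maps are $(i_{\mathfrak g}, 0)$ and $(i_{\mathfrak h}, x)$, and for any curved morphisms $(f_{\mathfrak g}, a): \mathfrak g \to \mathfrak e$ and $(f_{\mathfrak h}, b): \mathfrak h \to \mathfrak e$ there is a unique curved morphism $(f, a)$ from the coproduct to $\mathfrak e$ with $f|_{\mathfrak g} = f_{\mathfrak g}$, $f|_{\mathfrak h} = f_{\mathfrak h}$, $f(x) = b - a$, making both triangles commute. -/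

import Mathlib

/-- A curved Lie algebra over `k`: a `ℤ`-graded vector space with a graded Lie
bracket, a degree `1` derivation `d` and a curvature element `ω ∈ 𝔤²` with
`d ω = 0` and `d² = [ω, -]`. -/
structure CurvedLie (k : Type) [Field k] where
  L : Type
  [acg : AddCommGroup L]
  [mod : Module k L]
  gr : ℤ → Submodule k L
  internal : DirectSum.IsInternal gr
  br : L →ₗ[k] L →ₗ[k] L
  br_mem : ∀ (i j : ℤ) (x y : L), x ∈ gr i → y ∈ gr j → br x y ∈ gr (i + j)
  br_anti : ∀ (i j : ℤ) (x y : L), x ∈ gr i → y ∈ gr j →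
    br x y = -(((i * j).negOnePow : ℤ) • br y x)
  br_jac : ∀ (i j l : ℤ) (x y z : L), x ∈ gr i → y ∈ gr j → z ∈ gr l →
    ((i * l).negOnePow : ℤ) • br x (br y z) + ((i * j).negOnePow : ℤ) • br y (br z x)
      + ((j * l).negOnePow : ℤ) • br z (br x y) = 0
  d : L →ₗ[k] L
  d_deg : ∀ (i : ℤ) (x : L), x ∈ gr i → d x ∈ gr (i + 1)
  d_der : ∀ (i : ℤ) (x y : L), x ∈ gr i →
    d (br x y) = br (d x) y + (i.negOnePow : ℤ) • br x (d y)
  ω : L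
  ω_mem : ω ∈ gr 2
  d_ω : d ω = 0
  d_sq : ∀ x : L, d (d x) = br ω x

attribute [instance] CurvedLie.acg CurvedLie.mod

variable (k : Type) [Field k] [CharZero k]

/-- `(f, a)` is a curved morphism of curved Lie algebras `G → H`. -/
def IsCurvedMor (G H : CurvedLie k) (f : G.L →ₗ[k] H.L) (a : H.L) : Prop :=
  (∀ (i : ℤ) (x : G.L), x ∈ G.gr i → f x ∈ H.gr i) ∧
  (∀ x y : G.L, f (G.br x y) = H.br (f x) (f y)) ∧
  a ∈ H.gr 1 ∧
  (∀ x : G.L, f (G.d x) = H.d (f x) + H.br a (f x)) ∧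
  f G.ω = H.ω + H.d a + (2 : k)⁻¹ • H.br a a

section GradedBrackets

variable {K V W : Type} [Field K] [AddCommGroup V] [Module K V] [AddCommGroup W] [Module K W]

theorem coe_negOnePow_add (i j : ℤ) :
    ((i + j).negOnePow : ℤ) = (i.negOnePow : ℤ) * (j.negOnePow : ℤ) := by
  rw [Int.negOnePow_add, Units.val_mul]

theorem coe_negOnePow_eq_or (i : ℤ) :
    (i.negOnePow : ℤ) = 1 ∨ (i.negOnePow : ℤ) = -1 := by
  rcases Int.even_or_odd i with h | h
  · simp [Int.negOnePow_even i h]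
  · simp [Int.negOnePow_odd i h]

/-- A bilinear bracket satisfying the axioms of a graded Lie algebra with respect to a family of
submodules, which need not decompose the ambient module. -/
structure IsGradedLie (gr : ℤ → Submodule K V) (br : V →ₗ[K] V →ₗ[K] V) : Prop where
  mem : ∀ (i j : ℤ) (x y : V), x ∈ gr i → y ∈ gr j → br x y ∈ gr (i + j)
  anti : ∀ (i j : ℤ) (x y : V), x ∈ gr i → y ∈ gr j →
    br x y = -(((i * j).negOnePow : ℤ) • br y x)
  jac : ∀ (i j l : ℤ) (x y z : V), x ∈ gr i → y ∈ gr j → z ∈ gr l →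
    ((i * l).negOnePow : ℤ) • br x (br y z) + ((i * j).negOnePow : ℤ) • br y (br z x)
      + ((j * l).negOnePow : ℤ) • br z (br x y) = 0

theorem CurvedLie.isGradedLie (G : CurvedLie K) : IsGradedLie G.gr G.br :=
  ⟨G.br_mem, G.br_anti, G.br_jac⟩

namespace IsGradedLie

variable {gr : ℤ → Submodule K V} {br : V →ₗ[K] V →ₗ[K] V}

/-- The bracket with a homogeneous element is a graded derivation. -/
theorem leibniz (h : IsGradedLie gr br) {i j l : ℤ} {x y z : V}
    (hx : x ∈ gr i) (hy : y ∈ gr j) (hz : z ∈ gr l) :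
    br x (br y z) = br (br x y) z + ((i * j).negOnePow : ℤ) • br y (br x z) := by
  have h1 := h.jac i j l x y z hx hy hz
  have h2 := h.anti l i z x hz hx
  have h3 := h.anti l (i + j) z (br x y) hz (h.mem i j x y hx hy)
  rw [h2, h3, mul_add, coe_negOnePow_add, mul_comm l i, mul_comm l j] at h1
  simp only [map_neg, map_zsmul] at h1
  rcases coe_negOnePow_eq_or (i * j) with a | a <;>
  rcases coe_negOnePow_eq_or (i * l) with b | b <;>
  rcases coe_negOnePow_eq_or (j * l) with c | c <;>
  rw [a, b, c] at h1 <;> rw [a] <;>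
  first
  | linear_combination (norm := module) (1 : ℤ) • h1
  | linear_combination (norm := module) (-1 : ℤ) • h1

theorem comm_of_odd (h : IsGradedLie gr br) {x y : V} (hx : x ∈ gr 1) (hy : y ∈ gr 1) :
    br x y = br y x := by
  simpa using h.anti 1 1 x y hx hy

theorem anti_of_even (h : IsGradedLie gr br) {i : ℤ} {x y : V} (hx : x ∈ gr i) (hy : y ∈ gr 2) :
    br x y = -br y x := by
  have := h.anti i 2 x y hx hy
  rwa [mul_comm, Int.negOnePow_two_mul, Units.val_one, one_smul] at this

/-- The adjoint action of the square of an odd element. -/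
theorem bracket_sq_bracket [CharZero K] (h : IsGradedLie gr br) {i : ℤ} {x y : V}
    (hx : x ∈ gr 1) (hy : y ∈ gr i) :
    (2 : K)⁻¹ • br (br x x) y = br x (br x y) := by
  have := h.leibniz hx hx hy
  simp only [mul_one, Int.negOnePow_one, Units.val_neg, Units.val_one, neg_smul, one_smul] at this
  rw [inv_smul_eq_iff₀ two_ne_zero, two_smul]
  linear_combination (norm := module) -this

theorem bracket_sq_self [CharZero K] (h : IsGradedLie gr br) {x : V} (hx : x ∈ gr 1) :
    br (br x x) x = 0 := by
  have h1 := h.jac 1 1 1 x x x hx hx hx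
  have h2 := h.bracket_sq_bracket hx hx
  simp only [mul_one, Int.negOnePow_one, Units.val_neg, Units.val_one, neg_smul, one_smul] at h1
  rw [← h2] at h1
  have h3 : (3 * 2⁻¹ : K) • br (br x x) x = 0 := by linear_combination (norm := module) -h1
  exact (smul_eq_zero.mp h3).resolve_left (by norm_num)

theorem bracket_self_sq [CharZero K] (h : IsGradedLie gr br) {x : V} (hx : x ∈ gr 1) :
    br x (br x x) = 0 := by
  have hxx : br x x ∈ gr 2 := h.mem 1 1 x x hx hx
  rw [h.anti_of_even hx hxx, h.bracket_sq_self hx, neg_zero]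

end IsGradedLie

/-- A family of submodules that spans and is separated by linear projections decomposes the
module. -/
theorem isInternal_of_projections {gr : ℤ → Submodule K V} (p : ℤ → V →ₗ[K] V)
    (hsame : ∀ i, ∀ x ∈ gr i, p i x = x) (hne : ∀ i j, i ≠ j → ∀ x ∈ gr i, p j x = 0)
    (htop : iSup gr = ⊤) : DirectSum.IsInternal gr := by
  rw [DirectSum.isInternal_submodule_iff_iSupIndep_and_iSup_eq_top]
  refine ⟨fun i => ?_, htop⟩
  rw [Submodule.disjoint_def]
  intro x hx hx'
  have hker : (⨆ j, ⨆ (_ : j ≠ i), gr j) ≤ LinearMap.ker (p i) :=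
    iSup₂_le fun j hj y hy => hne j i hj y hy
  rw [← hsame i x hx]
  exact hker hx'

/-- An internally graded vector space has a homogeneous basis. -/
theorem exists_homogeneous_basis {gr : ℤ → Submodule K V} (h : DirectSum.IsInternal gr) :
    ∃ (κ : Type) (deg : κ → ℤ) (b : Module.Basis κ K V), (∀ s, b s ∈ gr (deg s)) ∧
      ∀ i, gr i ≤ Submodule.span K (b '' {s | deg s = i}) := by
  let v i := Module.Basis.ofVectorSpace K (gr i)
  refine ⟨_, Sigma.fst, h.collectedBasis v, h.collectedBasis_mem v, fun i y hy => ?_⟩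
  have hspan := Submodule.mem_map_of_mem (f := (gr i).subtype) ((v i).mem_span ⟨y, hy⟩)
  rw [Submodule.map_span] at hspan
  refine Submodule.span_mono ?_ hspan
  rintro _ ⟨_, ⟨t, rfl⟩, rfl⟩
  exact ⟨⟨i, t⟩, rfl, by simp [h.collectedBasis_coe v]⟩

theorem mem_of_homogeneous_basis {κ : Type} {gr : ℤ → Submodule K V} {gr' : ℤ → Submodule K W}
    {deg : κ → ℤ} {b : κ → V} (hb : ∀ i, gr i ≤ Submodule.span K (b '' {s | deg s = i}))
    {r : ℤ} {f : V →ₗ[K] W} (hf : ∀ s, f (b s) ∈ gr' (deg s + r)) {i : ℤ} {x : V}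
    (hx : x ∈ gr i) : f x ∈ gr' (i + r) := by
  suffices Submodule.span K (b '' {s | deg s = i}) ≤ (gr' (i + r)).comap f from this (hb i hx)
  rw [Submodule.span_le]
  rintro _ ⟨s, rfl, rfl⟩
  exact hf s

end GradedBrackets

section Presentation

variable {K X V : Type} [Field K] [AddCommGroup V] [Module K V]

/-- The free nonassociative algebra on `X`. -/
abbrev FreeBracketAlgebra (K X : Type) [Field K] : Type := FreeMagma X →₀ K

noncomputable section

/-- A bracket word, as an element of the free nonassociative algebra. -/
def bracketWord (m : FreeMagma X) : FreeBracketAlgebra K X := Finsupp.single m 1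

theorem linearCombination_bracketWord {M : Type} [AddCommMonoid M] [Module K M]
    (v : FreeMagma X → M) (m : FreeMagma X) :
    Finsupp.linearCombination K v (bracketWord m) = v m := by
  simp [bracketWord]

theorem FreeBracketAlgebra.hom_ext {f g : FreeBracketAlgebra K X →ₗ[K] V}
    (h : ∀ m, f (bracketWord m) = g (bracketWord m)) : f = g :=
  Finsupp.lhom_ext' fun m => LinearMap.ext_ring (h m)

theorem mem_span_bracketWord (a : FreeBracketAlgebra K X) :
    a ∈ Submodule.span K (Set.range (bracketWord (K := K) (X := X))) := by
  have h := (Finsupp.basisSingleOne (R := K) (ι := FreeMagma X)).mem_span a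
  rwa [Finsupp.coe_basisSingleOne] at h

/-- The product of the free nonassociative algebra. -/
def freeBracket :
    FreeBracketAlgebra K X →ₗ[K] FreeBracketAlgebra K X →ₗ[K] FreeBracketAlgebra K X :=
  Finsupp.linearCombination K fun m => Finsupp.linearCombination K fun n => bracketWord (m * n)

@[simp]
theorem freeBracket_bracketWord (m n : FreeMagma X) :
    freeBracket (bracketWord m) (bracketWord n) = bracketWord (K := K) (m * n) := by
  rw [freeBracket, linearCombination_bracketWord, linearCombination_bracketWord]

variable (deg : X → ℤ)

/-- The degree of a bracket word in graded generators. -/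
def wordDegree : FreeMagma X → ℤ
  | .of x => deg x
  | .mul m n => wordDegree m + wordDegree n

theorem wordDegree_mul (m n : FreeMagma X) :
    wordDegree deg (m * n) = wordDegree deg m + wordDegree deg n := rfl

/-- The homogeneous components of the free nonassociative algebra. -/
def freeGrading (i : ℤ) : Submodule K (FreeBracketAlgebra K X) :=
  Submodule.span K (bracketWord '' {m | wordDegree deg m = i})

theorem bracketWord_mem (m : FreeMagma X) :
    bracketWord (K := K) m ∈ freeGrading deg (wordDegree deg m) :=
  Submodule.subset_span ⟨m, rfl, rfl⟩

variable {deg}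

theorem bracketWord_mem_of_eq {m : FreeMagma X} {i : ℤ} (h : wordDegree deg m = i) :
    bracketWord (K := K) m ∈ freeGrading deg i :=
  h ▸ bracketWord_mem deg m

theorem map_mem_of_bracketWord {gr : ℤ → Submodule K V} {r : ℤ}
    {f : FreeBracketAlgebra K X →ₗ[K] V}
    (hf : ∀ m, f (bracketWord m) ∈ gr (wordDegree deg m + r)) {i : ℤ}
    {a : FreeBracketAlgebra K X} (ha : a ∈ freeGrading deg i) : f a ∈ gr (i + r) := by
  suffices freeGrading deg i ≤ (gr (i + r)).comap f from this ha
  rw [freeGrading, Submodule.span_le]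
  rintro _ ⟨m, rfl, rfl⟩
  exact hf m

theorem freeBracket_mem {i j : ℤ} {a b : FreeBracketAlgebra K X}
    (ha : a ∈ freeGrading deg i) (hb : b ∈ freeGrading deg j) :
    freeBracket a b ∈ freeGrading deg (i + j) := by
  refine map_mem_of_bracketWord (f := freeBracket.flip b) (fun m => ?_) ha
  rw [LinearMap.flip_apply, add_comm]
  refine map_mem_of_bracketWord (f := freeBracket (bracketWord m)) (fun n => ?_) hb
  rw [freeBracket_bracketWord, add_comm, ← wordDegree_mul]
  exact bracketWord_mem deg _

variable (deg)

/-- The projection onto the component of degree `i`. -/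
def freeProjection (i : ℤ) : FreeBracketAlgebra K X →ₗ[K] FreeBracketAlgebra K X :=
  Finsupp.linearCombination K fun m => if wordDegree deg m = i then bracketWord m else 0

variable {deg}

theorem freeProjection_of_mem {i : ℤ} {a : FreeBracketAlgebra K X}
    (ha : a ∈ freeGrading deg i) (j : ℤ) :
    freeProjection deg j a = if i = j then a else 0 := by
  induction ha using Submodule.span_induction with
  | mem _ h =>
    obtain ⟨m, rfl, rfl⟩ := h
    rw [freeProjection, linearCombination_bracketWord]
  | zero => simp
  | add _ _ _ _ h1 h2 => rw [map_add, h1, h2]; split_ifs <;> simp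
  | smul _ _ _ h => rw [map_smul, h]; split_ifs <;> simp

variable (deg)
variable (R : Set (FreeBracketAlgebra K X))

/-- Generators, as a vector space, of the ideal imposing the relations `R` and the axioms of a
graded Lie algebra. -/
inductive LieRelation : FreeBracketAlgebra K X → Prop
  | base (r : FreeBracketAlgebra K X) : r ∈ R → LieRelation r
  | anti (m n : FreeMagma X) : LieRelation
      (bracketWord (m * n)
        + ((wordDegree deg m * wordDegree deg n).negOnePow : ℤ) • bracketWord (n * m))
  | jac (m n p : FreeMagma X) : LieRelation
      (((wordDegree deg m * wordDegree deg p).negOnePow : ℤ) • bracketWord (m * (n * p))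
        + ((wordDegree deg m * wordDegree deg n).negOnePow : ℤ) • bracketWord (n * (p * m))
        + ((wordDegree deg n * wordDegree deg p).negOnePow : ℤ) • bracketWord (p * (m * n)))
  | left (m : FreeMagma X) (r : FreeBracketAlgebra K X) :
      LieRelation r → LieRelation (freeBracket (bracketWord m) r)
  | right (m : FreeMagma X) (r : FreeBracketAlgebra K X) :
      LieRelation r → LieRelation (freeBracket r (bracketWord m))

/-- The ideal of relations of the graded Lie algebra with generators `X` and relations `R`. -/
def relationIdeal : Submodule K (FreeBracketAlgebra K X) :=
  Submodule.span K {r | LieRelation deg R r}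

variable {deg R}

theorem LieRelation.homogeneous (hR : ∀ r ∈ R, ∃ i, r ∈ freeGrading deg i)
    {r : FreeBracketAlgebra K X} (h : LieRelation deg R r) : ∃ i, r ∈ freeGrading deg i := by
  induction h with
  | base r hr => exact hR r hr
  | anti m n =>
    exact ⟨_, add_mem (bracketWord_mem deg _)
      (zsmul_mem (bracketWord_mem_of_eq (by simp only [wordDegree_mul]; ring)) _)⟩
  | jac m n p =>
    exact ⟨_, add_mem (add_mem (zsmul_mem (bracketWord_mem deg _) _)
      (zsmul_mem (bracketWord_mem_of_eq (by simp only [wordDegree_mul]; ring)) _))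
      (zsmul_mem (bracketWord_mem_of_eq (by simp only [wordDegree_mul]; ring)) _)⟩
  | left m r _ ih =>
    obtain ⟨i, hi⟩ := ih
    exact ⟨_, freeBracket_mem (bracketWord_mem deg m) hi⟩
  | right m r _ ih =>
    obtain ⟨i, hi⟩ := ih
    exact ⟨_, freeBracket_mem hi (bracketWord_mem deg m)⟩

theorem freeProjection_mem_relationIdeal (hR : ∀ r ∈ R, ∃ i, r ∈ freeGrading deg i) (j : ℤ) :
    relationIdeal deg R ≤ (relationIdeal deg R).comap (freeProjection deg j) := by
  conv_lhs => rw [relationIdeal]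
  rw [Submodule.span_le]
  intro r hr
  obtain ⟨i, hi⟩ := hr.homogeneous hR
  change freeProjection deg j r ∈ relationIdeal deg R
  rw [freeProjection_of_mem hi]
  split_ifs
  · exact Submodule.subset_span hr
  · exact zero_mem _

theorem bracket_mem_relationIdeal_left (a : FreeBracketAlgebra K X)
    {r : FreeBracketAlgebra K X} (hr : r ∈ relationIdeal deg R) :
    freeBracket a r ∈ relationIdeal deg R := by
  have ha := mem_span_bracketWord a
  induction ha using Submodule.span_induction with
  | mem _ h =>
    obtain ⟨m, rfl⟩ := h
    suffices relationIdeal deg R ≤ (relationIdeal deg R).comap (freeBracket (bracketWord m)) from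
      this hr
    exact Submodule.span_le.mpr fun r hr => Submodule.subset_span (hr.left m)
  | zero => simp
  | add _ _ _ _ h1 h2 => rw [map_add]; exact add_mem h1 h2
  | smul c _ _ h => rw [map_smul]; exact Submodule.smul_mem _ c h

theorem bracket_mem_relationIdeal_right (a : FreeBracketAlgebra K X)
    {r : FreeBracketAlgebra K X} (hr : r ∈ relationIdeal deg R) :
    freeBracket r a ∈ relationIdeal deg R := by
  have ha := mem_span_bracketWord a
  induction ha using Submodule.span_induction with
  | mem _ h =>
    obtain ⟨m, rfl⟩ := h
    suffices relationIdeal deg R ≤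
        (relationIdeal deg R).comap (freeBracket.flip (bracketWord m)) from this hr
    exact Submodule.span_le.mpr fun r hr => Submodule.subset_span (hr.right m)
  | zero => simp
  | add _ _ _ _ h1 h2 => rw [map_add]; exact add_mem h1 h2
  | smul c _ _ h => rw [map_smul]; exact Submodule.smul_mem _ c h

variable (deg R)

/-- The graded Lie algebra with generators `X` and relations `R`. -/
abbrev PresentedLie : Type := FreeBracketAlgebra K X ⧸ relationIdeal deg R

namespace PresentedLie

/-- The quotient map from the free nonassociative algebra. -/
abbrev mk : FreeBracketAlgebra K X →ₗ[K] PresentedLie deg R := (relationIdeal deg R).mkQ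

/-- The Lie bracket of a presented graded Lie algebra. -/
def bracket : PresentedLie deg R →ₗ[K] PresentedLie deg R →ₗ[K] PresentedLie deg R :=
  (relationIdeal deg R).liftQ
    ((relationIdeal deg R).liftQ (freeBracket.compr₂ (mk deg R)).flip fun r hr => by
      refine LinearMap.ext fun a => ?_
      exact (Submodule.Quotient.mk_eq_zero _).mpr (bracket_mem_relationIdeal_left a hr)).flip
    fun r hr => by
      refine LinearMap.ext fun y => ?_
      obtain ⟨a, rfl⟩ := Submodule.mkQ_surjective _ y
      exact (Submodule.Quotient.mk_eq_zero _).mpr (bracket_mem_relationIdeal_right a hr)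

/-- The homogeneous components of a presented graded Lie algebra. -/
def grading (i : ℤ) : Submodule K (PresentedLie deg R) := (freeGrading deg i).map (mk deg R)

variable {deg R}

theorem mk_freeBracket (a b : FreeBracketAlgebra K X) :
    mk deg R (freeBracket a b) = bracket deg R (mk deg R a) (mk deg R b) := rfl

theorem mk_mul (m n : FreeMagma X) :
    mk deg R (bracketWord (m * n)) =
      bracket deg R (mk deg R (bracketWord m)) (mk deg R (bracketWord n)) := by
  rw [← mk_freeBracket, freeBracket_bracketWord]

theorem mk_relation {r : FreeBracketAlgebra K X} (h : LieRelation deg R r) : mk deg R r = 0 :=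
  (Submodule.Quotient.mk_eq_zero _).mpr (Submodule.subset_span h)

theorem mk_mem {i : ℤ} {a : FreeBracketAlgebra K X} (ha : a ∈ freeGrading deg i) :
    mk deg R a ∈ grading deg R i :=
  Submodule.mem_map_of_mem ha

theorem mk_word_mem (m : FreeMagma X) :
    mk deg R (bracketWord m) ∈ grading deg R (wordDegree deg m) :=
  mk_mem (bracketWord_mem deg m)

theorem hom_ext {f g : PresentedLie deg R →ₗ[K] V}
    (h : ∀ m, f (mk deg R (bracketWord m)) = g (mk deg R (bracketWord m))) : f = g :=
  Submodule.linearMap_qext _ (FreeBracketAlgebra.hom_ext h)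

theorem grading_eq_span (i : ℤ) : grading deg R i =
    Submodule.span K ((fun m => mk deg R (bracketWord m)) '' {m | wordDegree deg m = i}) := by
  rw [grading, freeGrading, Submodule.map_span, Set.image_image]

theorem map_mem_of_word {gr : ℤ → Submodule K V} {r : ℤ} {f : PresentedLie deg R →ₗ[K] V}
    (hf : ∀ m, f (mk deg R (bracketWord m)) ∈ gr (wordDegree deg m + r)) {i : ℤ}
    {a : PresentedLie deg R} (ha : a ∈ grading deg R i) : f a ∈ gr (i + r) := by
  obtain ⟨a, ha, rfl⟩ := ha
  exact map_mem_of_bracketWord (f := f ∘ₗ mk deg R) hf ha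

theorem isInternal_grading (hR : ∀ r ∈ R, ∃ i, r ∈ freeGrading deg i) :
    DirectSum.IsInternal (grading deg R) := by
  have key : ∀ i j, ∀ x ∈ grading deg R i,
      (relationIdeal deg R).mapQ _ _ (freeProjection_mem_relationIdeal hR j) x
        = if i = j then x else 0 := by
    rintro i j _ ⟨a, ha, rfl⟩
    rw [Submodule.mkQ_apply, Submodule.mapQ_apply, freeProjection_of_mem ha]
    split_ifs <;> rfl
  refine isInternal_of_projections
    (fun j => (relationIdeal deg R).mapQ _ _ (freeProjection_mem_relationIdeal hR j))
    (fun i x hx => by rw [key i i x hx, if_pos rfl])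
    (fun i j hij x hx => by rw [key i j x hx, if_neg hij]) (top_unique ?_)
  rintro x -
  obtain ⟨a, rfl⟩ := Submodule.mkQ_surjective _ x
  have ha := mem_span_bracketWord a
  induction ha using Submodule.span_induction with
  | mem _ h =>
    obtain ⟨m, rfl⟩ := h
    exact Submodule.mem_iSup_of_mem _ (mk_word_mem m)
  | zero => rw [map_zero]; exact zero_mem _
  | add _ _ _ _ h1 h2 => rw [map_add]; exact add_mem h1 h2
  | smul c _ _ h => rw [map_smul]; exact Submodule.smul_mem _ c h

theorem isGradedLie : IsGradedLie (grading deg R) (bracket deg R) where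
  mem := by
    rintro i j _ _ ⟨a, ha, rfl⟩ ⟨b, hb, rfl⟩
    exact mk_mem (freeBracket_mem ha hb)
  anti i j x y hx hy := by
    rw [grading_eq_span] at hx hy
    induction hx, hy using Submodule.span_induction₂ with
    | mem_mem _ _ hx hy =>
      obtain ⟨m, rfl, rfl⟩ := hx
      obtain ⟨n, rfl, rfl⟩ := hy
      have h := mk_relation (LieRelation.anti (deg := deg) (R := R) m n)
      rw [map_add, map_zsmul, mk_mul, mk_mul] at h
      exact eq_neg_of_add_eq_zero_left h
    | zero_left => simp
    | zero_right => simp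
    | add_left _ _ _ _ _ _ h1 h2 =>
      simp only [map_add, LinearMap.add_apply]
      linear_combination (norm := module) h1 + h2
    | add_right _ _ _ _ _ _ h1 h2 =>
      simp only [map_add, LinearMap.add_apply]
      linear_combination (norm := module) h1 + h2
    | smul_left c _ _ _ _ h =>
      simp only [map_smul, LinearMap.smul_apply]
      linear_combination (norm := module) c • h
    | smul_right c _ _ _ _ h =>
      simp only [map_smul, LinearMap.smul_apply]
      linear_combination (norm := module) c • h
  jac i j l x y z hx hy hz := by
    rw [grading_eq_span] at hx hy hz
    induction hx using Submodule.span_induction with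
    | mem _ hx =>
      obtain ⟨m, rfl, rfl⟩ := hx
      induction hy, hz using Submodule.span_induction₂ with
      | mem_mem _ _ hy hz =>
        obtain ⟨n, rfl, rfl⟩ := hy
        obtain ⟨p, rfl, rfl⟩ := hz
        have h := mk_relation (LieRelation.jac (deg := deg) (R := R) m n p)
        simpa only [map_add, map_zsmul, mk_mul] using h
      | zero_left => simp
      | zero_right => simp
      | add_left _ _ _ _ _ _ h1 h2 =>
        simp only [map_add, LinearMap.add_apply]
        linear_combination (norm := module) h1 + h2
      | add_right _ _ _ _ _ _ h1 h2 =>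
        simp only [map_add, LinearMap.add_apply]
        linear_combination (norm := module) h1 + h2
      | smul_left c _ _ _ _ h =>
        simp only [map_smul, LinearMap.smul_apply]
        linear_combination (norm := module) c • h
      | smul_right c _ _ _ _ h =>
        simp only [map_smul, LinearMap.smul_apply]
        linear_combination (norm := module) c • h
    | zero => simp
    | add _ _ _ _ h1 h2 =>
      simp only [map_add, LinearMap.add_apply]
      linear_combination (norm := module) h1 + h2
    | smul c _ _ h =>
      simp only [map_smul, LinearMap.smul_apply]
      linear_combination (norm := module) c • h

end PresentedLie

variable {deg R}

section Derivation

variable (deg)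
variable (D₀ : X → FreeBracketAlgebra K X)

/-- The values on bracket words of the graded derivation with prescribed values on generators. -/
def derivationWord : FreeMagma X → FreeBracketAlgebra K X
  | .of x => D₀ x
  | .mul m n => freeBracket (derivationWord m) (bracketWord n)
      + ((wordDegree deg m).negOnePow : ℤ) • freeBracket (bracketWord m) (derivationWord n)

/-- The odd derivation of the free nonassociative algebra with prescribed values on generators. -/
def freeDerivation : FreeBracketAlgebra K X →ₗ[K] FreeBracketAlgebra K X :=
  Finsupp.linearCombination K (derivationWord deg D₀)

variable {deg D₀}

theorem freeDerivation_of (x : X) : freeDerivation deg D₀ (bracketWord (.of x)) = D₀ x :=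
  linearCombination_bracketWord _ _

theorem freeDerivation_mul (m n : FreeMagma X) :
    freeDerivation deg D₀ (bracketWord (m * n)) =
      freeBracket (freeDerivation deg D₀ (bracketWord m)) (bracketWord n)
        + ((wordDegree deg m).negOnePow : ℤ) •
          freeBracket (bracketWord m) (freeDerivation deg D₀ (bracketWord n)) := by
  simp only [freeDerivation, linearCombination_bracketWord]
  rfl

theorem freeDerivation_word_mem (hD : ∀ x, D₀ x ∈ freeGrading deg (deg x + 1))
    (m : FreeMagma X) :
    freeDerivation deg D₀ (bracketWord m) ∈ freeGrading deg (wordDegree deg m + 1) := by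
  induction m with
  | ih1 x => rw [freeDerivation_of]; exact hD x
  | ih2 m n hm hn =>
    rw [freeDerivation_mul, wordDegree_mul]
    refine add_mem ?_ (zsmul_mem ?_ _)
    · rw [add_right_comm]
      exact freeBracket_mem hm (bracketWord_mem deg n)
    · rw [add_assoc]
      exact freeBracket_mem (bracketWord_mem deg m) hn

theorem freeDerivation_freeBracket {i : ℤ} {a : FreeBracketAlgebra K X}
    (ha : a ∈ freeGrading deg i) (b : FreeBracketAlgebra K X) :
    freeDerivation deg D₀ (freeBracket a b) = freeBracket (freeDerivation deg D₀ a) b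
      + (i.negOnePow : ℤ) • freeBracket a (freeDerivation deg D₀ b) := by
  have hb := mem_span_bracketWord b
  induction ha, hb using Submodule.span_induction₂ with
  | mem_mem _ _ hx hy =>
    obtain ⟨m, rfl, rfl⟩ := hx
    obtain ⟨n, rfl⟩ := hy
    rw [freeBracket_bracketWord, freeDerivation_mul]
  | zero_left => simp
  | zero_right => simp
  | add_left _ _ _ _ _ _ h1 h2 =>
    simp only [map_add, LinearMap.add_apply]
    linear_combination (norm := module) h1 + h2
  | add_right _ _ _ _ _ _ h1 h2 =>
    simp only [map_add]
    linear_combination (norm := module) h1 + h2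
  | smul_left c _ _ _ _ h =>
    simp only [map_smul, LinearMap.smul_apply]
    linear_combination (norm := module) c • h
  | smul_right c _ _ _ _ h =>
    simp only [map_smul]
    linear_combination (norm := module) c • h

namespace PresentedLie

theorem mk_freeDerivation_relation (hR : ∀ r ∈ R, ∃ i, r ∈ freeGrading deg i)
    (hD : ∀ x, D₀ x ∈ freeGrading deg (deg x + 1))
    (hDR : ∀ r ∈ R, mk deg R (freeDerivation deg D₀ r) = 0) {r : FreeBracketAlgebra K X}
    (h : LieRelation deg R r) :
    mk deg R (freeDerivation deg D₀ r) = 0 := by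
  have hw := fun m => mk_word_mem (K := K) (deg := deg) (R := R) m
  have hdw := fun m => mk_mem (R := R) (freeDerivation_word_mem hD m)
  induction h with
  | base r hr => exact hDR r hr
  | anti m n =>
    have h1 := isGradedLie.anti _ _ _ _ (hdw m) (hw n)
    have h2 := isGradedLie.anti _ _ _ _ (hdw n) (hw m)
    simp only [map_add, map_zsmul, freeDerivation_mul, mk_freeBracket]
    rw [h1, h2]
    simp only [add_mul, one_mul, coe_negOnePow_add, mul_comm (wordDegree deg n)]
    rcases coe_negOnePow_eq_or (wordDegree deg m) with a | a <;>
    rcases coe_negOnePow_eq_or (wordDegree deg n) with b | b <;>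
    rcases coe_negOnePow_eq_or (wordDegree deg m * wordDegree deg n) with c | c <;>
    rw [a, b, c] <;> module
  | jac m n p =>
    have h1 := congrArg (((wordDegree deg p).negOnePow : ℤ) • ·)
      (isGradedLie.jac _ _ _ _ _ _ (hdw m) (hw n) (hw p))
    have h2 := congrArg (((wordDegree deg m).negOnePow : ℤ) • ·)
      (isGradedLie.jac _ _ _ _ _ _ (hw m) (hdw n) (hw p))
    have h3 := congrArg (((wordDegree deg n).negOnePow : ℤ) • ·)
      (isGradedLie.jac _ _ _ _ _ _ (hw m) (hw n) (hdw p))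
    simp only [add_mul, mul_add, one_mul, mul_one, coe_negOnePow_add] at h1 h2 h3
    simp only [map_add, map_zsmul, freeDerivation_mul, mk_freeBracket, mk_mul]
    rcases coe_negOnePow_eq_or (wordDegree deg m) with a | a <;>
    rcases coe_negOnePow_eq_or (wordDegree deg n) with b | b <;>
    rcases coe_negOnePow_eq_or (wordDegree deg p) with c | c <;>
    simp only [a, b, c] at h1 h2 h3 ⊢ <;>
    linear_combination (norm := module) h1 + h2 + h3
  | left m r h ih =>
    rw [freeDerivation_freeBracket (bracketWord_mem deg m)]
    simp only [map_add, map_zsmul, mk_freeBracket, ih, mk_relation h, map_zero, smul_zero,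
      add_zero]
  | right m r h ih =>
    obtain ⟨i, hi⟩ := h.homogeneous hR
    rw [freeDerivation_freeBracket hi]
    simp only [map_add, map_zsmul, mk_freeBracket, ih, mk_relation h, map_zero, smul_zero,
      add_zero, LinearMap.zero_apply]

theorem relationIdeal_le_comap_freeDerivation (hR : ∀ r ∈ R, ∃ i, r ∈ freeGrading deg i)
    (hD : ∀ x, D₀ x ∈ freeGrading deg (deg x + 1))
    (hDR : ∀ r ∈ R, mk deg R (freeDerivation deg D₀ r) = 0) :
    relationIdeal deg R ≤ (relationIdeal deg R).comap (freeDerivation deg D₀) :=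
  Submodule.span_le.mpr fun _ h =>
    (Submodule.Quotient.mk_eq_zero (relationIdeal deg R)).mp
      (mk_freeDerivation_relation hR hD hDR h)

variable (h : relationIdeal deg R ≤ (relationIdeal deg R).comap (freeDerivation deg D₀))

/-- The derivation of a presented graded Lie algebra induced by a derivation of the free
nonassociative algebra that preserves the relations. -/
def derivation : PresentedLie deg R →ₗ[K] PresentedLie deg R :=
  (relationIdeal deg R).mapQ _ (freeDerivation deg D₀) h

theorem derivation_mk (a : FreeBracketAlgebra K X) :
    derivation h (mk deg R a) = mk deg R (freeDerivation deg D₀ a) := rfl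

theorem derivation_mem (hD : ∀ x, D₀ x ∈ freeGrading deg (deg x + 1)) {i : ℤ}
    {x : PresentedLie deg R} (hx : x ∈ grading deg R i) :
    derivation h x ∈ grading deg R (i + 1) :=
  map_mem_of_word (fun m => mk_mem (freeDerivation_word_mem hD m)) hx

theorem derivation_bracket {i : ℤ} {x : PresentedLie deg R} (hx : x ∈ grading deg R i)
    (y : PresentedLie deg R) :
    derivation h (bracket deg R x y) = bracket deg R (derivation h x) y
      + (i.negOnePow : ℤ) • bracket deg R x (derivation h y) := by
  obtain ⟨a, ha, rfl⟩ := hx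
  obtain ⟨b, rfl⟩ := Submodule.mkQ_surjective _ y
  rw [← mk_freeBracket, derivation_mk, freeDerivation_freeBracket ha, map_add, map_zsmul]
  rfl

theorem derivation_sq (hD : ∀ x, D₀ x ∈ freeGrading deg (deg x + 1)) {w : PresentedLie deg R}
    (hw : w ∈ grading deg R 2)
    (hgen : ∀ x, derivation h (mk deg R (D₀ x)) = bracket deg R w (mk deg R (bracketWord (.of x))))
    (y : PresentedLie deg R) : derivation h (derivation h y) = bracket deg R w y := by
  suffices derivation h ∘ₗ derivation h = bracket deg R w from DFunLike.congr_fun this y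
  refine hom_ext fun m => ?_
  rw [LinearMap.comp_apply]
  induction m with
  | ih1 x => rw [derivation_mk, freeDerivation_of, hgen]
  | ih2 m n hm hn =>
    have h1 := mk_word_mem (R := R) (deg := deg) (K := K) m
    have h2 := derivation_mem h hD h1
    rw [mk_mul, isGradedLie.leibniz hw h1 (mk_word_mem n), derivation_bracket h h1, map_add,
      map_zsmul, derivation_bracket h h2, derivation_bracket h h1, hm, hn,
      coe_negOnePow_add, Int.negOnePow_two_mul, Int.negOnePow_one, Units.val_one, Units.val_neg,
      Units.val_one]
    rcases coe_negOnePow_eq_or (wordDegree deg m) with a | a <;> rw [a] <;> module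

end PresentedLie

end Derivation

section Lift

variable {gr : ℤ → Submodule K V} (br : V →ₗ[K] V →ₗ[K] V) (φ : X → V)

/-- The evaluation of a bracket word. -/
def liftWord : FreeMagma X → V
  | .of x => φ x
  | .mul m n => br (liftWord m) (liftWord n)

/-- The bracket-preserving map from the free nonassociative algebra with prescribed values on
generators. -/
def freeLift : FreeBracketAlgebra K X →ₗ[K] V := Finsupp.linearCombination K (liftWord br φ)

variable {br φ}

theorem freeLift_of (x : X) : freeLift br φ (bracketWord (.of x)) = φ x :=
  linearCombination_bracketWord _ _

theorem freeLift_freeBracket (a b : FreeBracketAlgebra K X) :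
    freeLift br φ (freeBracket a b) = br (freeLift br φ a) (freeLift br φ b) := by
  suffices freeBracket.compr₂ (freeLift br φ) = br.compl₁₂ (freeLift br φ) (freeLift br φ) from
    LinearMap.congr_fun₂ this a b
  refine FreeBracketAlgebra.hom_ext fun m => FreeBracketAlgebra.hom_ext fun n => ?_
  simp only [LinearMap.compr₂_apply, LinearMap.compl₁₂_apply, freeBracket_bracketWord, freeLift,
    linearCombination_bracketWord]
  rfl

theorem freeLift_mul (m n : FreeMagma X) : freeLift br φ (bracketWord (m * n)) =
    br (freeLift br φ (bracketWord m)) (freeLift br φ (bracketWord n)) := by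
  rw [← freeLift_freeBracket, freeBracket_bracketWord]

theorem freeLift_word_mem (hV : IsGradedLie gr br) (hφ : ∀ x, φ x ∈ gr (deg x))
    (m : FreeMagma X) : freeLift br φ (bracketWord m) ∈ gr (wordDegree deg m) := by
  induction m with
  | ih1 x => rw [freeLift_of]; exact hφ x
  | ih2 m n hm hn => rw [freeLift_mul]; exact hV.mem _ _ _ _ hm hn

theorem freeLift_relation (hV : IsGradedLie gr br) (hφ : ∀ x, φ x ∈ gr (deg x))
    (hR : ∀ r ∈ R, freeLift br φ r = 0) {r : FreeBracketAlgebra K X}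
    (h : LieRelation deg R r) : freeLift br φ r = 0 := by
  have hm := freeLift_word_mem hV hφ
  induction h with
  | base r hr => exact hR r hr
  | anti m n =>
    rw [map_add, map_zsmul, freeLift_mul, freeLift_mul, hV.anti _ _ _ _ (hm m) (hm n),
      neg_add_cancel]
  | jac m n p =>
    simpa only [map_add, map_zsmul, freeLift_mul] using hV.jac _ _ _ _ _ _ (hm m) (hm n) (hm p)
  | left m r _ ih => rw [freeLift_freeBracket, ih, map_zero]
  | right m r _ ih => rw [freeLift_freeBracket, ih, map_zero, LinearMap.zero_apply]

namespace PresentedLie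

/-- The universal property of a presented graded Lie algebra. -/
theorem exists_lift (hV : IsGradedLie gr br) (hφ : ∀ x, φ x ∈ gr (deg x))
    (hR : ∀ r ∈ R, freeLift br φ r = 0) :
    ∃ f : PresentedLie deg R →ₗ[K] V, f ∘ₗ mk deg R = freeLift br φ ∧
      (∀ i, ∀ x ∈ grading deg R i, f x ∈ gr i) ∧
      ∀ x y, f (bracket deg R x y) = br (f x) (f y) := by
  have hle : relationIdeal deg R ≤ LinearMap.ker (freeLift br φ) :=
    Submodule.span_le.mpr fun _ h => freeLift_relation hV hφ hR h
  refine ⟨(relationIdeal deg R).liftQ _ hle, Submodule.liftQ_mkQ _ _ hle, fun i x hx => ?_,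
    fun x y => ?_⟩
  · simpa only [add_zero] using map_mem_of_word (r := 0)
      (fun m => (add_zero (wordDegree deg m)).symm ▸ freeLift_word_mem hV hφ m) hx
  · obtain ⟨a, rfl⟩ := Submodule.mkQ_surjective _ x
    obtain ⟨b, rfl⟩ := Submodule.mkQ_surjective _ y
    exact freeLift_freeBracket a b

theorem hom_ext_of {f g : PresentedLie deg R →ₗ[K] V}
    (hf : ∀ x y, f (bracket deg R x y) = br (f x) (f y))
    (hg : ∀ x y, g (bracket deg R x y) = br (g x) (g y))
    (h : ∀ x, f (mk deg R (bracketWord (.of x))) = g (mk deg R (bracketWord (.of x)))) :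
    f = g := by
  refine hom_ext fun m => ?_
  induction m with
  | ih1 x => exact h x
  | ih2 m n hm hn => rw [mk_mul, hf, hg, hm, hn]

/-- A morphism of graded Lie algebras intertwining twisted derivations on generators intertwines
them everywhere. -/
theorem map_derivation {D₀ : X → FreeBracketAlgebra K X}
    (h : relationIdeal deg R ≤ (relationIdeal deg R).comap (freeDerivation deg D₀))
    (E : CurvedLie K) {f : PresentedLie deg R →ₗ[K] E.L} {a : E.L} (ha : a ∈ E.gr 1)
    (hdeg : ∀ i, ∀ x ∈ grading deg R i, f x ∈ E.gr i)
    (hf : ∀ x y, f (bracket deg R x y) = E.br (f x) (f y))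
    (hgen : ∀ x, f (mk deg R (D₀ x)) = E.d (f (mk deg R (bracketWord (.of x))))
      + E.br a (f (mk deg R (bracketWord (.of x)))))
    (y : PresentedLie deg R) : f (derivation h y) = E.d (f y) + E.br a (f y) := by
  suffices f ∘ₗ derivation h = E.d ∘ₗ f + E.br a ∘ₗ f from DFunLike.congr_fun this y
  refine hom_ext fun m => ?_
  simp only [LinearMap.add_apply, LinearMap.comp_apply]
  induction m with
  | ih1 x => rw [derivation_mk, freeDerivation_of, hgen]
  | ih2 m n hm hn =>
    have h1 := mk_word_mem (R := R) (deg := deg) (K := K) m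
    have h2 := mk_word_mem (R := R) (deg := deg) (K := K) n
    rw [mk_mul, derivation_bracket h h1, map_add, map_zsmul, hf, hf, hf, hm, hn,
      E.d_der _ _ _ (hdeg _ _ h1), E.isGradedLie.leibniz ha (hdeg _ _ h1) (hdeg _ _ h2), one_mul]
    simp only [map_add, LinearMap.add_apply]
    module

end PresentedLie

end Lift

open PresentedLie

/-- A curved Lie algebra given by generators, relations, a derivation and a curvature element. -/
def PresentedLie.curvedLie {D₀ : X → FreeBracketAlgebra K X}
    (hR : ∀ r ∈ R, ∃ i, r ∈ freeGrading deg i)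
    (hD : ∀ x, D₀ x ∈ freeGrading deg (deg x + 1))
    (h : relationIdeal deg R ≤ (relationIdeal deg R).comap (freeDerivation deg D₀))
    (w : PresentedLie deg R) (hw : w ∈ grading deg R 2) (hdw : derivation h w = 0)
    (hgen : ∀ x,
      derivation h (mk deg R (D₀ x)) = bracket deg R w (mk deg R (bracketWord (.of x)))) :
    CurvedLie K where
  L := PresentedLie deg R
  gr := grading deg R
  internal := isInternal_grading hR
  br := bracket deg R
  br_mem := isGradedLie.mem
  br_anti := isGradedLie.anti
  br_jac := isGradedLie.jac
  d := derivation h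
  d_deg _ _ hx := derivation_mem h hD hx
  d_der _ _ y hx := derivation_bracket h hx y
  ω := w
  ω_mem := hw
  d_ω := hdw
  d_sq := derivation_sq h hD hw hgen

section Basis

variable {κ : Type} (b : Module.Basis κ K V) (g : κ → X)

/-- The linear map sending basis vectors to generators. -/
def basisWord : V →ₗ[K] FreeBracketAlgebra K X := b.constr K fun s => bracketWord (.of (g s))

theorem basisWord_basis (s : κ) : basisWord b g (b s) = bracketWord (.of (g s)) :=
  b.constr_basis K _ s

variable {b g}

theorem basisWord_mem {gr : ℤ → Submodule K V} {e : κ → ℤ}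
    (hb : ∀ i, gr i ≤ Submodule.span K (b '' {s | e s = i})) (hg : ∀ s, deg (g s) = e s) {i : ℤ}
    {y : V} (hy : y ∈ gr i) : basisWord b g y ∈ freeGrading deg i := by
  rw [← add_zero i]
  refine mem_of_homogeneous_basis hb (fun s => ?_) hy
  rw [basisWord_basis, add_zero]
  exact bracketWord_mem_of_eq (hg s)

theorem freeLift_basisWord {W : Type} [AddCommGroup W] [Module K W] {br : W →ₗ[K] W →ₗ[K] W}
    {φ : X → W} {f : V →ₗ[K] W} (h : ∀ s, φ (g s) = f (b s)) (y : V) :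
    freeLift br φ (basisWord b g y) = f y := by
  suffices freeLift br φ ∘ₗ basisWord b g = f from DFunLike.congr_fun this y
  refine b.ext fun s => ?_
  rw [LinearMap.comp_apply, basisWord_basis, freeLift_of, h]

variable (b g)

/-- The relations identifying brackets of generators with brackets of basis vectors. -/
def bracketRelations (br : V →ₗ[K] V →ₗ[K] V) : Set (FreeBracketAlgebra K X) :=
  Set.range fun p : κ × κ => basisWord b g (br (b p.1) (b p.2))
    - freeBracket (basisWord b g (b p.1)) (basisWord b g (b p.2))

variable {b g}

theorem bracketRelations_homogeneous {gr : ℤ → Submodule K V} {br : V →ₗ[K] V →ₗ[K] V}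
    (hV : IsGradedLie gr br) {e : κ → ℤ} (hbm : ∀ s, b s ∈ gr (e s))
    (hb : ∀ i, gr i ≤ Submodule.span K (b '' {s | e s = i})) (hg : ∀ s, deg (g s) = e s)
    {r : FreeBracketAlgebra K X} (hr : r ∈ bracketRelations b g br) :
    ∃ i, r ∈ freeGrading deg i := by
  obtain ⟨⟨s, t⟩, rfl⟩ := hr
  exact ⟨e s + e t, sub_mem (basisWord_mem hb hg (hV.mem _ _ _ _ (hbm s) (hbm t)))
    (freeBracket_mem (basisWord_mem hb hg (hbm s)) (basisWord_mem hb hg (hbm t)))⟩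

theorem freeLift_bracketRelations {W : Type} [AddCommGroup W] [Module K W]
    {br : W →ₗ[K] W →ₗ[K] W} {brV : V →ₗ[K] V →ₗ[K] V} {φ : X → W} {f : V →ₗ[K] W}
    (h : ∀ s, φ (g s) = f (b s)) (hf : ∀ y z, f (brV y z) = br (f y) (f z))
    {r : FreeBracketAlgebra K X} (hr : r ∈ bracketRelations b g brV) : freeLift br φ r = 0 := by
  obtain ⟨⟨s, t⟩, rfl⟩ := hr
  rw [map_sub, freeLift_freeBracket, freeLift_basisWord h, freeLift_basisWord h,
    freeLift_basisWord h, hf, sub_self]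

theorem PresentedLie.mk_basisWord_bracket {br : V →ₗ[K] V →ₗ[K] V}
    (hR : bracketRelations b g br ⊆ R) (y z : V) :
    mk deg R (basisWord b g (br y z))
      = bracket deg R (mk deg R (basisWord b g y)) (mk deg R (basisWord b g z)) := by
  suffices br.compr₂ (mk deg R ∘ₗ basisWord b g) = (bracket deg R).compl₁₂
      (mk deg R ∘ₗ basisWord b g) (mk deg R ∘ₗ basisWord b g) from
    LinearMap.congr_fun₂ this y z
  refine b.ext fun s => b.ext fun t => ?_
  simp only [LinearMap.compr₂_apply, LinearMap.compl₁₂_apply, LinearMap.comp_apply]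
  rw [← sub_eq_zero, ← mk_freeBracket, ← map_sub]
  exact mk_relation (.base _ (hR ⟨(s, t), rfl⟩))

end Basis

end

end Presentation

namespace CurvedCoproduct

noncomputable section

open PresentedLie

variable {K κ ν : Type} [Field K] {G H : CurvedLie K}
  (bG : Module.Basis κ K G.L) (bH : Module.Basis ν K H.L)

/-- The degrees of the generators of the coproduct. -/
def coproductDegree (eG : κ → ℤ) (eH : ν → ℤ) : κ ⊕ ν ⊕ Unit → ℤ :=
  Sum.elim eG (Sum.elim eH fun _ => 1)

/-- The words of the first factor of the coproduct. -/
abbrev freeInl : G.L →ₗ[K] FreeBracketAlgebra K (κ ⊕ ν ⊕ Unit) := basisWord bG Sum.inl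

/-- The words of the second factor of the coproduct. -/
abbrev freeInr : H.L →ₗ[K] FreeBracketAlgebra K (κ ⊕ ν ⊕ Unit) :=
  basisWord bH (Sum.inr ∘ Sum.inl)

/-- The additional generator of the coproduct, of degree `1`. -/
abbrev freeVar : FreeBracketAlgebra K (κ ⊕ ν ⊕ Unit) :=
  bracketWord (.of (Sum.inr (Sum.inr ())))

/-- The differential of the coproduct on generators. -/
def coproductDifferential : κ ⊕ ν ⊕ Unit → FreeBracketAlgebra K (κ ⊕ ν ⊕ Unit) :=
  Sum.elim (fun s => freeInl bG (G.d (bG s)))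
    (Sum.elim (fun t => freeInr bH (H.d (bH t)) - freeBracket freeVar (freeInr bH (bH t)))
      fun _ => freeInr bH H.ω - freeInl bG G.ω - (2 : K)⁻¹ • freeBracket freeVar freeVar)

/-- The relations of the coproduct. -/
def coproductRelations : Set (FreeBracketAlgebra K (κ ⊕ ν ⊕ Unit)) :=
  bracketRelations bG Sum.inl G.br ∪ bracketRelations bH (Sum.inr ∘ Sum.inl) H.br

variable {bG bH} {eG : κ → ℤ} {eH : ν → ℤ}

theorem freeDerivation_freeInl (y : G.L) :
    freeDerivation (coproductDegree eG eH) (coproductDifferential bG bH) (freeInl bG y)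
      = freeInl bG (G.d y) := by
  suffices freeDerivation (coproductDegree eG eH) (coproductDifferential bG bH) ∘ₗ freeInl bG
      = freeInl bG ∘ₗ G.d from DFunLike.congr_fun this y
  refine bG.ext fun s => ?_
  rw [LinearMap.comp_apply, basisWord_basis, freeDerivation_of]
  rfl

theorem freeDerivation_freeInr (y : H.L) :
    freeDerivation (coproductDegree eG eH) (coproductDifferential bG bH) (freeInr bH y)
      = freeInr bH (H.d y) - freeBracket freeVar (freeInr bH y) := by
  suffices freeDerivation (coproductDegree eG eH) (coproductDifferential bG bH) ∘ₗ freeInr bH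
      = freeInr bH ∘ₗ H.d - freeBracket freeVar ∘ₗ freeInr bH from DFunLike.congr_fun this y
  refine bH.ext fun s => ?_
  rw [LinearMap.comp_apply, basisWord_basis, freeDerivation_of]
  rfl

theorem freeDerivation_freeVar :
    freeDerivation (coproductDegree eG eH) (coproductDifferential bG bH) freeVar
      = freeInr bH H.ω - freeInl bG G.ω - (2 : K)⁻¹ • freeBracket freeVar freeVar :=
  freeDerivation_of _

theorem freeVar_mem :
    freeVar (K := K) ∈ freeGrading (coproductDegree eG eH) 1 :=
  bracketWord_mem_of_eq rfl

section

variable (hbG : ∀ s, bG s ∈ G.gr (eG s)) (hbH : ∀ t, bH t ∈ H.gr (eH t))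
  (hG : ∀ i, G.gr i ≤ Submodule.span K (bG '' {s | eG s = i}))
  (hH : ∀ i, H.gr i ≤ Submodule.span K (bH '' {t | eH t = i}))

include hG in
theorem freeInl_mem {i : ℤ} {y : G.L} (hy : y ∈ G.gr i) :
    freeInl bG y ∈ freeGrading (coproductDegree eG eH) i :=
  basisWord_mem (g := Sum.inl) hG (fun _ => rfl) hy

include hH in
theorem freeInr_mem {i : ℤ} {y : H.L} (hy : y ∈ H.gr i) :
    freeInr bH y ∈ freeGrading (coproductDegree eG eH) i :=
  basisWord_mem (g := Sum.inr ∘ Sum.inl) hH (fun _ => rfl) hy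

include hbG hbH hG hH in
theorem coproductRelations_homogeneous {r : FreeBracketAlgebra K (κ ⊕ ν ⊕ Unit)}
    (hr : r ∈ coproductRelations bG bH) : ∃ i, r ∈ freeGrading (coproductDegree eG eH) i := by
  rcases hr with hr | hr
  · exact bracketRelations_homogeneous (g := Sum.inl) G.isGradedLie hbG hG (fun _ => rfl) hr
  · exact bracketRelations_homogeneous (g := Sum.inr ∘ Sum.inl) H.isGradedLie hbH hH
      (fun _ => rfl) hr

include hbG hbH hG hH in
theorem coproductDifferential_mem (x : κ ⊕ ν ⊕ Unit) :
    coproductDifferential bG bH x ∈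
      freeGrading (coproductDegree eG eH) (coproductDegree eG eH x + 1) := by
  rcases x with s | t | _
  · exact freeInl_mem hG (G.d_deg _ _ (hbG s))
  · refine sub_mem (freeInr_mem hH (H.d_deg _ _ (hbH t))) ?_
    rw [add_comm]
    exact freeBracket_mem freeVar_mem (freeInr_mem hH (hbH t))
  · exact sub_mem (sub_mem (freeInr_mem hH H.ω_mem) (freeInl_mem hG G.ω_mem))
      (Submodule.smul_mem _ _ (freeBracket_mem freeVar_mem freeVar_mem))

theorem mk_freeInl_br (y z : G.L) :
    mk (coproductDegree eG eH) (coproductRelations bG bH) (freeInl bG (G.br y z)) =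
      bracket _ _ (mk _ _ (freeInl bG y)) (mk _ _ (freeInl bG z)) :=
  mk_basisWord_bracket Set.subset_union_left y z

theorem mk_freeInr_br (y z : H.L) :
    mk (coproductDegree eG eH) (coproductRelations bG bH) (freeInr bH (H.br y z)) =
      bracket _ _ (mk _ _ (freeInr bH y)) (mk _ _ (freeInr bH z)) :=
  mk_basisWord_bracket Set.subset_union_right y z

include hbG hbH hG hH in
theorem mk_freeDerivation_coproductRelations {r : FreeBracketAlgebra K (κ ⊕ ν ⊕ Unit)}
    (hr : r ∈ coproductRelations bG bH) :
    mk (coproductDegree eG eH) (coproductRelations bG bH)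
      (freeDerivation (coproductDegree eG eH) (coproductDifferential bG bH) r) = 0 := by
  rcases hr with ⟨⟨s, t⟩, rfl⟩ | ⟨⟨s, t⟩, rfl⟩
  · rw [map_sub, freeDerivation_freeInl, freeDerivation_freeBracket (freeInl_mem hG (hbG s)),
      freeDerivation_freeInl, freeDerivation_freeInl, G.d_der _ _ _ (hbG s)]
    simp only [map_sub, map_add, map_zsmul, mk_freeBracket, mk_freeInl_br]
    module
  · have hx := mk_mem (R := coproductRelations bG bH)
      (freeVar_mem (K := K) (eG := eG) (eH := eH))
    have hs := mk_mem (R := coproductRelations bG bH) (freeInr_mem (eG := eG) hH (hbH s))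
    have ht := mk_mem (R := coproductRelations bG bH) (freeInr_mem (eG := eG) hH (hbH t))
    have hj := isGradedLie.leibniz hx hs ht
    rw [one_mul] at hj
    rw [map_sub, freeDerivation_freeInr, freeDerivation_freeBracket (freeInr_mem hH (hbH s)),
      freeDerivation_freeInr, freeDerivation_freeInr, H.d_der _ _ _ (hbH s)]
    simp only [map_sub, map_add, map_zsmul, LinearMap.sub_apply, mk_freeBracket, mk_freeInr_br, hj]
    module

include hbG hbH hG hH in
theorem relationIdeal_coproduct_le :
    relationIdeal (coproductDegree eG eH) (coproductRelations bG bH) ≤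
      (relationIdeal (coproductDegree eG eH) (coproductRelations bG bH)).comap
        (freeDerivation (coproductDegree eG eH) (coproductDifferential bG bH)) :=
  relationIdeal_le_comap_freeDerivation
    (fun _ => coproductRelations_homogeneous hbG hbH hG hH)
    (coproductDifferential_mem hbG hbH hG hH)
    fun _ => mk_freeDerivation_coproductRelations hbG hbH hG hH

include hbH hG hH in
theorem derivation_sq_coproduct [CharZero K]
    (h : relationIdeal (coproductDegree eG eH) (coproductRelations bG bH) ≤
      (relationIdeal (coproductDegree eG eH) (coproductRelations bG bH)).comap
        (freeDerivation (coproductDegree eG eH) (coproductDifferential bG bH)))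
    (x : κ ⊕ ν ⊕ Unit) :
    derivation h (mk _ _ (coproductDifferential bG bH x)) =
      bracket _ _ (mk _ _ (freeInl bG G.ω)) (mk _ _ (bracketWord (.of x))) := by
  have hx := mk_mem (R := coproductRelations bG bH)
    (freeVar_mem (K := K) (eG := eG) (eH := eH))
  have hωH := mk_mem (R := coproductRelations bG bH) (freeInr_mem (eG := eG) hH H.ω_mem)
  have hωG := mk_mem (R := coproductRelations bG bH) (freeInl_mem (eH := eH) hG G.ω_mem)
  rw [derivation_mk]
  rcases x with s | t | _
  · change mk _ _ (freeDerivation _ _ (freeInl bG (G.d (bG s)))) = _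
    rw [freeDerivation_freeInl, G.d_sq, mk_freeInl_br, basisWord_basis]
  · have ht := mk_mem (R := coproductRelations bG bH) (freeInr_mem (eG := eG) hH (hbH t))
    have hgen : bracketWord (.of (Sum.inr (Sum.inl t))) = freeInr (κ := κ) bH (bH t) :=
      (basisWord_basis bH (Sum.inr ∘ Sum.inl) t).symm
    have hsq := isGradedLie.bracket_sq_bracket hx ht
    change mk _ _ (freeDerivation _ _
      (freeInr bH (H.d (bH t)) - freeBracket freeVar (freeInr bH (bH t)))) = _
    rw [map_sub, freeDerivation_freeInr, freeDerivation_freeBracket freeVar_mem,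
      freeDerivation_freeVar, freeDerivation_freeInr, H.d_sq, hgen]
    simp only [map_sub, map_add, map_zsmul, map_smul, LinearMap.sub_apply, LinearMap.smul_apply,
      mk_freeBracket, mk_freeInr_br, hsq, Int.negOnePow_one, Units.val_neg, Units.val_one]
    module
  · have h1 := isGradedLie.bracket_sq_self hx
    have h2 := isGradedLie.anti_of_even hx hωH
    have h3 := isGradedLie.anti_of_even hx hωG
    have h4 := isGradedLie.bracket_self_sq hx
    change mk _ _ (freeDerivation _ _
      (freeInr bH H.ω - freeInl bG G.ω - (2 : K)⁻¹ • freeBracket freeVar freeVar)) = _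
    simp only [map_sub, map_smul]
    rw [freeDerivation_freeInr, freeDerivation_freeInl,
      freeDerivation_freeBracket freeVar_mem, freeDerivation_freeVar, H.d_ω, G.d_ω]
    simp only [map_sub, map_add, map_zsmul, map_smul, map_zero, LinearMap.sub_apply,
      LinearMap.smul_apply, mk_freeBracket, h1, h2, h3, h4, Int.negOnePow_one, Units.val_neg,
      Units.val_one]
    module

end

end

end CurvedCoproduct

open PresentedLie CurvedCoproduct in
/-- Binary coproducts exist in the category of curved Lie
algebras: for curved Lie algebras `𝔤, 𝔥` there is a curved Lie algebra `P`
(realized as the free product `𝔤 * 𝔥 * L⟨x⟩` on a formal degree 1 generator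
`x`), with curvature `ω_𝔤`, differential restricting to `d_𝔤` on `𝔤`, to
`d_𝔥 - [x,-]` on `𝔥` and with `d x = ω_𝔥 - ω_𝔤 - ½[x,x]`, whose structure
maps are the curved morphisms `(i_𝔤, 0)` and `(i_𝔥, x)`, and which satisfies
the universal property: any pair of curved morphisms `(f_𝔤, a) : 𝔤 → 𝔢`,
`(f_𝔥, b) : 𝔥 → 𝔢` factors through a unique curved morphism `(f, a) : P → 𝔢`
with `f ∘ i_𝔤 = f_𝔤`, `f ∘ i_𝔥 = f_𝔥` and `f x = b - a`. -/
theorem curved_Lie_binary_coproduct_exists (G H : CurvedLie k) :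
    ∃ (P : CurvedLie k) (x : P.L) (iG : G.L →ₗ[k] P.L) (iH : H.L →ₗ[k] P.L),
      x ∈ P.gr 1 ∧
      IsCurvedMor k G P iG 0 ∧
      IsCurvedMor k H P iH x ∧
      -- the curvature of the coproduct is (the image of) ω_𝔤
      P.ω = iG G.ω ∧
      -- the differential restricts to d_𝔤 on 𝔤 and to d_𝔥 - [x, -] on 𝔥,
      -- and d x = ω_𝔥 - ω_𝔤 - ½ [x, x]
      (∀ y : G.L, P.d (iG y) = iG (G.d y)) ∧
      (∀ y : H.L, P.d (iH y) = iH (H.d y) - P.br x (iH y)) ∧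
      P.d x = iH H.ω - iG G.ω - (2 : k)⁻¹ • P.br x x ∧
      -- universal property
      (∀ (E : CurvedLie k) (fG : G.L →ₗ[k] E.L) (a : E.L) (fH : H.L →ₗ[k] E.L) (b : E.L),
        IsCurvedMor k G E fG a → IsCurvedMor k H E fH b →
        ∃! f : P.L →ₗ[k] E.L,
          IsCurvedMor k P E f a ∧ f.comp iG = fG ∧ f.comp iH = fH ∧ f x = b - a) := by
  obtain ⟨κ, eG, bG, hbG, hG⟩ := exists_homogeneous_basis G.internal
  obtain ⟨ν, eH, bH, hbH, hH⟩ := exists_homogeneous_basis H.internal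
  have hle := relationIdeal_coproduct_le hbG hbH hG hH
  have hx := mk_mem (R := coproductRelations bG bH)
    (freeVar_mem (K := k) (eG := eG) (eH := eH))
  have hωG := mk_mem (R := coproductRelations bG bH) (freeInl_mem (eH := eH) hG G.ω_mem)
  have hdx : derivation hle (mk _ _ freeVar) = mk _ _ (freeInr bH H.ω) - mk _ _ (freeInl bG G.ω)
      - (2 : k)⁻¹ • bracket _ _ (mk _ _ freeVar) (mk _ _ freeVar) := by
    rw [derivation_mk, freeDerivation_freeVar, map_sub, map_sub, map_smul, mk_freeBracket]
  have hdG (y : G.L) : derivation hle (mk _ _ (freeInl bG y)) = mk _ _ (freeInl bG (G.d y)) := by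
    rw [derivation_mk, freeDerivation_freeInl]
  have hdH (y : H.L) : derivation hle (mk _ _ (freeInr bH y)) = mk _ _ (freeInr bH (H.d y))
      - bracket _ _ (mk _ _ freeVar) (mk _ _ (freeInr bH y)) := by
    rw [derivation_mk, freeDerivation_freeInr, map_sub, mk_freeBracket]
  have hdG_zero (y : G.L) : mk _ _ (freeInl bG (G.d y)) =
      derivation hle (mk _ _ (freeInl bG y)) + bracket _ _ 0 (mk _ _ (freeInl bG y)) := by
    rw [hdG, map_zero, LinearMap.zero_apply, add_zero]
  have hωG_zero : mk _ _ (freeInl bG G.ω) = mk _ _ (freeInl bG G.ω) + derivation hle 0 +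
      (2 : k)⁻¹ • bracket _ (coproductRelations bG bH) 0 0 := by
    simp only [map_zero, smul_zero, add_zero]
  have hωH : mk _ _ (freeInr bH H.ω) = mk _ _ (freeInl bG G.ω) + derivation hle (mk _ _ freeVar)
      + (2 : k)⁻¹ • bracket _ _ (mk _ _ freeVar) (mk _ _ freeVar) := by
    rw [hdx]
    abel
  refine ⟨PresentedLie.curvedLie
      (fun _ => coproductRelations_homogeneous hbG hbH hG hH)
      (coproductDifferential_mem hbG hbH hG hH) hle (mk _ _ (freeInl bG G.ω)) hωG
      (by rw [hdG, G.d_ω, map_zero, map_zero]) (derivation_sq_coproduct hbH hG hH hle),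
    mk _ _ freeVar, mk _ _ ∘ₗ freeInl bG, mk _ _ ∘ₗ freeInr bH, hx,
    ⟨fun i y hy => mk_mem (freeInl_mem hG hy), mk_freeInl_br, zero_mem _, hdG_zero, hωG_zero⟩,
    ⟨fun i y hy => mk_mem (freeInr_mem hH hy), mk_freeInr_br, hx,
      fun y => eq_add_of_sub_eq (hdH y).symm, hωH⟩,
    rfl, hdG, hdH, hdx, ?_⟩
  rintro E fG a fH b ⟨hG1, hG2, ha, hG3, hG4⟩ ⟨hH1, hH2, hb, hH3, hH4⟩
  let φ : κ ⊕ ν ⊕ Unit → E.L :=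
    Sum.elim (fun s => fG (bG s)) (Sum.elim (fun t => fH (bH t)) fun _ => b - a)
  have hφ (x) : φ x ∈ E.gr (coproductDegree eG eH x) := by
    rcases x with s | t | _
    · exact hG1 _ _ (hbG s)
    · exact hH1 _ _ (hbH t)
    · exact sub_mem hb ha
  obtain ⟨f, hf, hfdeg, hfbr⟩ := exists_lift (R := coproductRelations bG bH) E.isGradedLie hφ
    fun r hr => hr.elim (freeLift_bracketRelations (g := Sum.inl) (fun _ => rfl) hG2)
      (freeLift_bracketRelations (g := Sum.inr ∘ Sum.inl) (fun _ => rfl) hH2)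
  have hfG (y) : f (mk _ _ (freeInl bG y)) = fG y :=
    (DFunLike.congr_fun hf _).trans (freeLift_basisWord (g := Sum.inl) (fun _ => rfl) y)
  have hfH (y) : f (mk _ _ (freeInr bH y)) = fH y :=
    (DFunLike.congr_fun hf _).trans
      (freeLift_basisWord (g := Sum.inr ∘ Sum.inl) (fun _ => rfl) y)
  have hfgen (x) : f (mk _ _ (bracketWord (.of x))) = φ x :=
    (DFunLike.congr_fun hf _).trans (freeLift_of x)
  refine ⟨f, ⟨⟨hfdeg, hfbr, ha, map_derivation hle E ha hfdeg hfbr fun x => ?_, ?_⟩,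
    LinearMap.ext hfG, LinearMap.ext hfH, hfgen _⟩, ?_⟩
  · rw [hfgen]
    rcases x with s | t | _
    · exact (hfG _).trans (hG3 _)
    · change f (mk _ _ (freeInr bH (H.d (bH t)) - freeBracket freeVar (freeInr bH (bH t)))) =
        E.d (fH (bH t)) + E.br a (fH (bH t))
      rw [map_sub, map_sub, mk_freeBracket, hfbr, hfH, hfH, hfgen, hH3]
      change _ - E.br (b - a) _ = _
      rw [map_sub, LinearMap.sub_apply]
      abel
    · change f (mk _ _ (freeInr bH H.ω - freeInl bG G.ω
        - (2 : k)⁻¹ • freeBracket freeVar freeVar)) = E.d (b - a) + E.br a (b - a)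
      simp only [map_sub, map_smul]
      rw [mk_freeBracket, hfbr, hfH, hfG, hfgen, hG4, hH4]
      change _ - (2 : k)⁻¹ • E.br (b - a) (b - a) = _
      simp only [map_sub, LinearMap.sub_apply]
      rw [E.isGradedLie.comm_of_odd hb ha]
      module
  · exact (hfG _).trans hG4
  · rintro f' ⟨⟨-, hbr', -⟩, hG', hH', hx'⟩
    have freeInr_basis (t : ν) : freeInr (κ := κ) bH (bH t) =
        bracketWord (.of (Sum.inr (Sum.inl t))) :=
      basisWord_basis bH (Sum.inr ∘ Sum.inl) t
    refine hom_ext_of hbr' hfbr fun x => ?_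
    rw [hfgen]
    rcases x with s | t | _
    · rw [← basisWord_basis bG Sum.inl s]
      exact DFunLike.congr_fun hG' (bG s)
    · rw [← freeInr_basis t]
      exact DFunLike.congr_fun hH' (bH t)
    · exact hx'
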